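/- Let E ⊆ 𝕋^d be simple, compact, with finitely many connected components. Then for every b ∈ 𝕋^d, ConvexHull_{𝕋^d}(b·E) = b · ConvexHull_{𝕋^d}(E). -/

import Mathlib

open scoped Real
noncomputable section

/-- The torus `𝕋^d = (𝕊¹)^d`. -/
abbrev Torus (d : ℕ) := Fin d → Circle

variable {d : ℕ}

/-- Componentwise multiplication of a set by a point: `a·E = {a·z : z ∈ E}`. -/
def smulSet (a : Torus d) (E : Set (Torus d)) : Set (Torus d) := (fun z => a * z) '' E

/-- The componentwise principal argument `arg : 𝕋^d → (−π,π]^d`. -/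
def targ (z : Torus d) : Fin d → ℝ := fun j => Complex.arg (z j)

/-- `arg(E)` for a subset `E ⊆ 𝕋^d`. -/
def argSet (E : Set (Torus d)) : Set (Fin d → ℝ) := targ '' E

/-- The Euclidean norm on `ℝ^d`. -/
def eunorm (v : Fin d → ℝ) : ℝ := Real.sqrt (∑ j, v j ^ 2)

/-- The distance `d^{𝕋^d}(z,w) = min_{θ ∈ (2πℤ)^d} ‖arg z − arg w + θ‖`. -/
def torusDist (z w : Torus d) : ℝ :=
  sInf {r | ∃ θ : Fin d → ℤ, r = eunorm (fun j => targ z j - targ w j + 2 * π * θ j)}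

/-- The Hausdorff distance on `𝕋^d` induced by `torusDist`. -/
def torusHD (A B : Set (Torus d)) : ℝ :=
  sInf {ε | 0 < ε ∧ (∀ a ∈ A, ∃ b ∈ B, torusDist a b ≤ ε) ∧
      (∀ b ∈ B, ∃ a ∈ A, torusDist a b ≤ ε)}

/-- `E ⊆ 𝕋^d` is very simple if no coordinate of a point of `E` equals `−1`. -/
def VerySimple (E : Set (Torus d)) : Prop := ∀ z ∈ E, ∀ j, (z j : ℂ) ≠ -1

/-- `E ⊆ 𝕋^d` is simple if no coordinate projection restricted to `E` is onto. -/
def Simple (E : Set (Torus d)) : Prop := ∀ j, (fun z : Torus d => z j) '' E ≠ Set.univ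

/-- `E` has finitely many connected components. -/
def FinComps (E : Set (Torus d)) : Prop :=
  {C : Set (Torus d) | ∃ z ∈ E, C = connectedComponentIn E z}.Finite

/-- `E₁, …, E_N` are the connected components of `E`. -/
def IsConnComps {N : ℕ} (E : Set (Torus d)) (Ec : Fin N → Set (Torus d)) : Prop :=
  (∀ i, ∃ z ∈ E, Ec i = connectedComponentIn E z) ∧ (∀ z ∈ E, ∃ i, z ∈ Ec i) ∧
    Function.Injective Ec

/-- `exp(iF) ⊆ 𝕋^d` for `F ⊆ ℝ^d`. -/
def expSet (F : Set (Fin d → ℝ)) : Set (Torus d) :=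
  {z | ∃ θ ∈ F, ∀ j, z j = Circle.exp (θ j)}

/-- `diam(η_j(arg(c·E)))`. -/
def etaDiam (E : Set (Torus d)) (c : Torus d) (j : Fin d) : ℝ :=
  Metric.diam ((fun z : Torus d => Complex.arg ((c j * z j : Circle) : ℂ)) '' E)

/-- The set `Λ_j = {diam(η_j(arg(c·E))) : c·E very simple}`. -/
def Lambda (E : Set (Torus d)) (j : Fin d) : Set ℝ :=
  {r | ∃ c : Torus d, VerySimple (smulSet c E) ∧ r = etaDiam E c j}

/-- `b` is admissible for `E`. -/
def Admissible (b : Torus d) (E : Set (Torus d)) : Prop :=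
  VerySimple (smulSet b E) ∧ ∀ j, IsLeast (Lambda E j) (etaDiam E b j)

/-- All phase shifts of `E` with respect to `(b,c)` are equal (to a common `θ ∈ (2πℤ)^d`). -/
def PhaseShifted (b c : Torus d) (E : Set (Torus d)) : Prop :=
  ∃ θ : Fin d → ℤ, ∀ z ∈ E, ∀ j,
    Complex.arg ((c j * z j : Circle) : ℂ) =
      Complex.arg ((b j * z j : Circle) : ℂ) +
        Complex.arg ((c j * (b j)⁻¹ : Circle) : ℂ) + 2 * π * θ j

/-- `E` is generic: for every pair of admissible points, all the phase shifts are equal. -/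
def Generic (E : Set (Torus d)) : Prop :=
  ∀ b c : Torus d, Admissible b E → Admissible c E → PhaseShifted b c E

/-- Euclidean distance between two subsets of `ℝ^d`. -/
def setDistR (A B : Set (Fin d → ℝ)) : ℝ :=
  sInf {r | ∃ x ∈ A, ∃ y ∈ B, r = eunorm (x - y)}

/-- The boundary of the cube `[−π,π]^d`. -/
def cubeBoundary (d : ℕ) : Set (Fin d → ℝ) :=
  frontier (Set.univ.pi fun _ : Fin d => Set.Icc (-π) π)

open Classical in
/-- The convex hull of a simple compact subset of `𝕋^d` with finitely many connected
components: if `E` is generic (and admits an admissible point), it is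
`b⁻¹·exp(i ConvexHull(arg(b·E)))` for an admissible point `b`; otherwise it is `𝕋^d`. -/
noncomputable def torusConvexHull {d : ℕ} (E : Set (Torus d)) : Set (Torus d) :=
  if h : Generic E ∧ ∃ b : Torus d, Admissible b E then
    smulSet (h.2.choose)⁻¹ (expSet (convexHull ℝ (argSet (smulSet h.2.choose E))))
  else Set.univ

theorem mem_smulSet_iff {d : ℕ} (a : Torus d) (E : Set (Torus d)) (z : Torus d) :
    z ∈ smulSet a E ↔ a⁻¹ * z ∈ E := by
  constructor
  · rintro ⟨w, hw, rfl⟩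
    simpa using hw
  · exact fun h => ⟨_, h, by simp⟩

theorem smulSet_smulSet {d : ℕ} (a b : Torus d) (E : Set (Torus d)) :
    smulSet a (smulSet b E) = smulSet (a * b) E := by
  simp only [smulSet, Set.image_image, mul_assoc]

theorem smulSet_univ {d : ℕ} (a : Torus d) : smulSet a Set.univ = Set.univ := by
  ext z
  simp [mem_smulSet_iff]

theorem etaDiam_smulSet {d : ℕ} (b c : Torus d) (E : Set (Torus d)) (j : Fin d) :
    etaDiam (smulSet b E) c j = etaDiam E (c * b) j := by
  simp only [etaDiam, smulSet, Set.image_image, Pi.mul_apply, mul_assoc]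

theorem Lambda_smulSet {d : ℕ} (b : Torus d) (E : Set (Torus d)) (j : Fin d) :
    Lambda (smulSet b E) j = Lambda E j := by
  ext r
  simp only [Lambda, Set.mem_ofPred_eq, smulSet_smulSet, etaDiam_smulSet]
  constructor
  · rintro ⟨c, h⟩
    exact ⟨c * b, h⟩
  · rintro ⟨c, h⟩
    exact ⟨c * b⁻¹, by simpa using h⟩

theorem admissible_smulSet_iff {d : ℕ} (b c : Torus d) (E : Set (Torus d)) :
    Admissible c (smulSet b E) ↔ Admissible (c * b) E := by
  simp only [Admissible, smulSet_smulSet, Lambda_smulSet, etaDiam_smulSet]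

theorem phaseShifted_smulSet_iff {d : ℕ} (a b c : Torus d) (E : Set (Torus d)) :
    PhaseShifted b c (smulSet a E) ↔ PhaseShifted (b * a) (c * a) E := by
  have h : ∀ j, c j * a j * ((a j)⁻¹ * (b j)⁻¹) = c j * (b j)⁻¹ := fun j => by group
  simp only [PhaseShifted, smulSet, Set.forall_mem_image, Pi.mul_apply, mul_inv_rev, h, mul_assoc]

theorem generic_smulSet_iff {d : ℕ} (a : Torus d) (E : Set (Torus d)) :
    Generic (smulSet a E) ↔ Generic E := by
  simp only [Generic, admissible_smulSet_iff, phaseShifted_smulSet_iff]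
  constructor
  · intro h b c hb hc
    simpa using h (b * a⁻¹) (c * a⁻¹) (by simpa using hb) (by simpa using hc)
  · exact fun h b c => h _ _

theorem exists_admissible_smulSet_iff {d : ℕ} (a : Torus d) (E : Set (Torus d)) :
    (∃ b, Admissible b (smulSet a E)) ↔ ∃ b, Admissible b E := by
  simp only [admissible_smulSet_iff]
  constructor
  · rintro ⟨b, h⟩
    exact ⟨_, h⟩
  · rintro ⟨b, h⟩
    exact ⟨b * a⁻¹, by simpa using h⟩

theorem expSet_image_add {d : ℕ} (v : Fin d → ℝ) (F : Set (Fin d → ℝ)) :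
    expSet ((fun x => v + x) '' F) = smulSet (fun j => Circle.exp (v j)) (expSet F) := by
  ext z
  simp only [mem_smulSet_iff, expSet, Set.mem_ofPred_eq, Set.exists_mem_image, Pi.add_apply,
    Circle.exp_add, Pi.mul_apply, Pi.inv_apply, inv_mul_eq_iff_eq_mul]

theorem exp_arg_add_two_pi_mul_int (z : Circle) (n : ℤ) :
    Circle.exp (Complex.arg z + 2 * π * n) = z := by
  rw [Circle.exp_add, Circle.exp_arg, mul_comm (2 * π), Circle.exp_int_mul_two_pi, mul_one]

/-- The set defining the convex hull does not change under an equal phase shift. -/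
theorem PhaseShifted.smulSet_expSet_convexHull_eq {d : ℕ} {b c : Torus d} {E : Set (Torus d)}
    (h : PhaseShifted b c E) :
    smulSet c⁻¹ (expSet (convexHull ℝ (argSet (smulSet c E)))) =
      smulSet b⁻¹ (expSet (convexHull ℝ (argSet (smulSet b E)))) := by
  obtain ⟨θ, hθ⟩ := h
  set v : Fin d → ℝ := fun j => Complex.arg ((c j * (b j)⁻¹ : Circle) : ℂ) + 2 * π * θ j with hv
  have harg : argSet (smulSet c E) = (fun x => v + x) '' argSet (smulSet b E) := by
    simp only [argSet, smulSet, Set.image_image]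
    refine Set.image_congr fun z hz => funext fun j => ?_
    have := hθ z hz j
    simp only [targ, hv, Pi.add_apply, Pi.mul_apply]
    linarith
  have hexp : (fun j => Circle.exp (v j)) = c * b⁻¹ :=
    funext fun j => exp_arg_add_two_pi_mul_int _ _
  have hhull : convexHull ℝ ((fun x => v + x) '' argSet (smulSet b E)) =
      (fun x => v + x) '' convexHull ℝ (argSet (smulSet b E)) := by
    have := convexHull_vadd (𝕜 := ℝ) v (argSet (smulSet b E))
    simpa only [← Set.image_vadd, vadd_eq_add] using this
  rw [harg, hhull, expSet_image_add, hexp, smulSet_smulSet, inv_mul_cancel_left]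

theorem Generic.torusConvexHull_eq {d : ℕ} {E : Set (Torus d)} (hE : Generic E) {b : Torus d}
    (hb : Admissible b E) :
    torusConvexHull E = smulSet b⁻¹ (expSet (convexHull ℝ (argSet (smulSet b E)))) := by
  have h : Generic E ∧ ∃ b : Torus d, Admissible b E := ⟨hE, b, hb⟩
  rw [torusConvexHull, dif_pos h]
  exact (hE _ _ hb h.2.choose_spec).smulSet_expSet_convexHull_eq

/-- The toric convex hull is compatible with rotations: for `E ⊆ 𝕋^d` simple
and compact with finitely many connected components,
`ConvexHull_{𝕋^d}(b·E) = b·ConvexHull_{𝕋^d}(E)` for every `b ∈ 𝕋^d`. -/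
theorem torusConvexHull_smul {d : ℕ} (E : Set (Torus d))
    (hS : Simple E) (hC : IsCompact E) (hF : FinComps E) (b : Torus d) :
    torusConvexHull (smulSet b E) = smulSet b (torusConvexHull E) := by
  by_cases h : Generic E ∧ ∃ c : Torus d, Admissible c E
  · obtain ⟨hE, c, hc⟩ := h
    have hc' : Admissible (c * b⁻¹) (smulSet b E) := by
      simpa [admissible_smulSet_iff] using hc
    rw [hE.torusConvexHull_eq hc, ((generic_smulSet_iff b E).2 hE).torusConvexHull_eq hc']
    simp only [smulSet_smulSet, mul_inv_rev, inv_inv, inv_mul_cancel_right]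
  · have h' : ¬(Generic (smulSet b E) ∧ ∃ c : Torus d, Admissible c (smulSet b E)) := by
      rwa [generic_smulSet_iff, exists_admissible_smulSet_iff]
    rw [torusConvexHull, torusConvexHull, dif_neg h, dif_neg h', smulSet_univ]
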